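/- arXiv:2511.13304 — 2 statements merged into one kernel-verified Lean document; each statement's English description precedes it below -/
import Mathlib

section
/- If S is a cyclic finite sequence of natural numbers and T is a sublist of S, then T is cyclic. -/
/-- A finite sequence `s = (a_1, ..., a_t)` of natural numbers is *cyclic* if there is
at most one index `i ∈ {1, ..., t}` with `a_i > a_{i+1}`, where `a_{t+1}` denotes `a_1`. -/
def List.IsCyclicSeq (s : List ℕ) : Prop :=
  (s.zip (s.rotate 1)).countP (fun p => decide (p.2 < p.1)) ≤ 1

/-- The number of descents along the path that starts at `x`, follows `l` and ends at `z`. -/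
def pathDescents (z : ℕ) : ℕ → List ℕ → ℕ
  | x, [] => if z < x then 1 else 0
  | x, y :: l => (if y < x then 1 else 0) + pathDescents z y l

lemma countP_zip_eq_pathDescents (z x : ℕ) (l : List ℕ) :
    ((x :: l).zip (l ++ [z])).countP (fun p => decide (p.2 < p.1)) = pathDescents z x l := by
  induction l generalizing x with
  | nil => simp [pathDescents, List.countP_cons]
  | cons y l ih =>
    rw [List.cons_append, List.zip_cons_cons, List.countP_cons, ih, pathDescents]
    simp [add_comm]

lemma isCyclicSeq_cons_iff (x : ℕ) (l : List ℕ) :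
    (x :: l).IsCyclicSeq ↔ pathDescents x x l ≤ 1 := by
  rw [List.IsCyclicSeq, List.rotate_cons_succ, List.rotate_zero, countP_zip_eq_pathDescents]

lemma pathDescents_le_start (z x y : ℕ) (l : List ℕ) :
    pathDescents z x l ≤ (if y < x then 1 else 0) + pathDescents z y l := by
  cases l <;> simp only [pathDescents] <;> split_ifs <;> omega

lemma pathDescents_le_end (z w x : ℕ) (l : List ℕ) :
    pathDescents w x l ≤ pathDescents z x l + (if w < z then 1 else 0) := by
  induction l generalizing x with
  | nil => simp only [pathDescents]; split_ifs <;> omega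
  | cons y l ih => simpa only [pathDescents, add_assoc] using Nat.add_le_add_left (ih y) _

lemma pathDescents_le_of_sublist {S T : List ℕ} (h : T.Sublist S) (z x : ℕ) :
    pathDescents z x T ≤ pathDescents z x S := by
  induction h generalizing x with
  | slnil => exact le_rfl
  | cons y _ ih =>
    exact (pathDescents_le_start z x y _).trans (Nat.add_le_add_left (ih y) _)
  | cons_cons y _ ih => exact Nat.add_le_add_left (ih y) _

theorem sublist_of_cyclic_is_cyclic
    (S T : List ℕ) (hS : S.IsCyclicSeq) (hTS : T.Sublist S) :
    T.IsCyclicSeq := by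
  cases hTS with
  | slnil => exact hS
  | cons_cons a h =>
    rw [isCyclicSeq_cons_iff] at hS ⊢
    exact (pathDescents_le_of_sublist h a a).trans hS
  | cons a h =>
    cases T with
    | nil => simp [List.IsCyclicSeq]
    | cons b t =>
      rw [isCyclicSeq_cons_iff] at hS ⊢
      have hmono := pathDescents_le_of_sublist h a a
      have hend := pathDescents_le_end a b b t
      rw [pathDescents] at hmono
      omega
end

section
/- Let S be a finite sequence of natural numbers whose set of distinct values has cardinality not equal to 2. If every subsequence of S of length 3 is cyclic, then S is cyclic. -/
theorem List.isCyclicSeq_triple_iff (a b c : ℕ) :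
    List.IsCyclicSeq [a, b, c] ↔
      ¬ (c < b ∧ b < a) ∧ ¬ (b < a ∧ a < c) ∧ ¬ (a < c ∧ c < b) := by
  simp only [List.IsCyclicSeq, List.rotate_cons_succ, List.rotate_zero, List.cons_append,
    List.nil_append, List.zip_cons_cons, List.zip_nil_right, List.countP_cons, List.countP_nil,
    decide_eq_true_eq]
  split_ifs <;> omega

theorem List.triple_sublist {α : Type*} {l : List α} {p q r : ℕ} (hpq : p < q) (hqr : q < r)
    (hr : r < l.length) : [l[p], l[q], l[r]].Sublist l := by
  have hpairwise : List.Pairwise (· < ·)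
      [(⟨p, by omega⟩ : Fin l.length), ⟨q, by omega⟩, ⟨r, hr⟩] := by
    simp [hpq, hqr, hpq.trans hqr]
  exact List.map_getElem_sublist hpairwise

theorem List.exists_two_getElem_of_two_le_countP {α : Type*} {p : α → Bool} {l : List α}
    (h : 2 ≤ l.countP p) :
    ∃ (i j : ℕ) (hij : i < j) (hj : j < l.length), p l[i] ∧ p l[j] := by
  have h' : 2 ≤ (l.map p).count true := by
    rw [List.count_eq_countP, List.countP_map]
    convert h using 2
    funext x
    simp
  rw [← List.duplicate_iff_two_le_count, List.duplicate_iff_exists_distinct_get] at h'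
  obtain ⟨i, j, hij, hi, hj⟩ := h'
  refine ⟨i, j, hij, by simpa using j.2, ?_, ?_⟩
  · simpa using hi.symm
  · simpa using hj.symm

/-- If the number of distinct values of `S` is not `2` and every length-3 subsequence of `S`
is cyclic, then `S` is cyclic. -/
theorem isCyclicSeq_of_rank_ne_two_of_length_three_sublists_cyclic
    (S : List ℕ) (hrank : S.toFinset.card ≠ 2)
    (h3 : ∀ T : List ℕ, T.Sublist S → T.length = 3 → T.IsCyclicSeq) :
    S.IsCyclicSeq := by
  by_contra hS
  obtain ⟨i, j, hij, hj, hdi, hdj⟩ :=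
    List.exists_two_getElem_of_two_le_countP (Nat.lt_of_not_le hS)
  replace hj : j < S.length := by simpa using hj
  have hmod : (i + 1) % S.length = i + 1 := Nat.mod_eq_of_lt (by omega)
  simp only [List.getElem_zip, List.getElem_rotate, decide_eq_true_eq, hmod] at hdi hdj
  obtain ⟨k, hk, hk', hkt⟩ : ∃ k, k = (j + 1) % S.length ∧ (k = j + 1 ∨ k = 0 ∧ j + 1 = S.length) ∧
      k < S.length := by
    refine ⟨_, rfl, ?_, Nat.mod_lt _ (by omega)⟩
    rcases (show j + 1 < S.length ∨ j + 1 = S.length by omega) with h | h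
    · exact .inl (Nat.mod_eq_of_lt h)
    · exact .inr ⟨by simp [h], h⟩
  simp only [← hk] at hdj
  -- The condition on triples is invariant under rotation and vacuous at repeated positions.
  have key : ∀ p q r (hp : p < S.length) (hq : q < S.length) (hr : r < S.length),
      (p ≤ q ∧ q ≤ r) ∨ (q ≤ r ∧ r ≤ p) ∨ (r ≤ p ∧ p ≤ q) →
      ¬ (S[r] < S[q] ∧ S[q] < S[p]) ∧ ¬ (S[q] < S[p] ∧ S[p] < S[r]) ∧
        ¬ (S[p] < S[r] ∧ S[r] < S[q]) := by
    intro p q r hp hq hr h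
    by_cases hpq : p = q
    · subst hpq; omega
    by_cases hqr : q = r
    · subst hqr; omega
    by_cases hpr : p = r
    · subst hpr; omega
    have tri : ∀ {p q r : ℕ} (hpq : p < q) (hqr : q < r) (hr : r < S.length), _ :=
      fun hpq hqr hr => (List.isCyclicSeq_triple_iff _ _ _).1
        (h3 _ (List.triple_sublist hpq hqr hr) rfl)
    rcases h with h | h | h
    · have := tri (show p < q by omega) (show q < r by omega) hr
      omega
    · have := tri (show q < r by omega) (show r < p by omega) hp
      omega
    · have := tri (show r < p by omega) (show p < q by omega) hq
      omega
  have hi : i < S.length := by omega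
  have hi' : i + 1 < S.length := by omega
  have h₁ := key i (i + 1) j hi hi' hj (by omega)
  have h₂ := key i (i + 1) k hi hi' hkt (by omega)
  have h₃ := key j k i hj hkt hi (by omega)
  have h₄ := key j k (i + 1) hj hkt hi' (by omega)
  have hx : S[j] = S[i] := by omega
  have hy : S[k] = S[i + 1] := by omega
  clear h₁ h₂ h₃ h₄
  apply hrank
  rw [Finset.card_eq_two]
  refine ⟨S[i], S[i + 1], by omega, ?_⟩
  ext v
  simp only [List.mem_toFinset, Finset.mem_insert, Finset.mem_singleton]
  constructor
  · intro hv
    obtain ⟨m, hm, rfl⟩ := List.getElem_of_mem hv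
    by_cases hc : i + 1 ≤ m ∧ m ≤ j
    · have h₁ := key i (i + 1) m hi hi' hm (by omega)
      have h₂ := key i m k hi hm hkt (by omega)
      clear hc hk'
      omega
    · have h₁ := key j k m hj hkt hm (by omega)
      have h₂ := key j m (i + 1) hj hm hi' (by omega)
      clear hc hk'
      omega
  · rintro (rfl | rfl) <;> exact List.getElem_mem _
end
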